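/- The element d is regular in 𝒜, the set {d^n : n ∈ ℕ} is a left and right Ore set in 𝒜, and Φ_1 extends to an isomorphism of ℂ(q)-algebras from the Ore localization of 𝒜 at {d^n : n ∈ ℕ} onto U_q, sending d^{-1} to K. -/

import Mathlib

noncomputable section

abbrev Kq : Type := RatFunc ℂ

/-- The indeterminate `q`. -/
noncomputable def qv : Kq := RatFunc.X

/-- Generators `a`, `b`, `c`, `d` of the algebra `𝒜 = ℒ_{0,1}(sl(2))`. -/
inductive AGen : Type
  | a | b | c | d

/-- The defining relations of `𝒜 = ℒ_{0,1}(sl(2))`. -/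
inductive ARel : FreeAlgebra Kq AGen → FreeAlgebra Kq AGen → Prop
  | ad_comm : ARel (FreeAlgebra.ι Kq AGen.a * FreeAlgebra.ι Kq AGen.d)
      (FreeAlgebra.ι Kq AGen.d * FreeAlgebra.ι Kq AGen.a)
  | db : ARel (FreeAlgebra.ι Kq AGen.d * FreeAlgebra.ι Kq AGen.b)
      ((qv ^ 2) • (FreeAlgebra.ι Kq AGen.b * FreeAlgebra.ι Kq AGen.d))
  | cd : ARel (FreeAlgebra.ι Kq AGen.c * FreeAlgebra.ι Kq AGen.d)
      ((qv ^ 2) • (FreeAlgebra.ι Kq AGen.d * FreeAlgebra.ι Kq AGen.c))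
  | ab : ARel (FreeAlgebra.ι Kq AGen.a * FreeAlgebra.ι Kq AGen.b
        - FreeAlgebra.ι Kq AGen.b * FreeAlgebra.ι Kq AGen.a)
      ((-(1 - qv⁻¹ ^ 2)) • (FreeAlgebra.ι Kq AGen.b * FreeAlgebra.ι Kq AGen.d))
  | cb : ARel (FreeAlgebra.ι Kq AGen.c * FreeAlgebra.ι Kq AGen.b
        - FreeAlgebra.ι Kq AGen.b * FreeAlgebra.ι Kq AGen.c)
      ((1 - qv⁻¹ ^ 2) • (FreeAlgebra.ι Kq AGen.d * FreeAlgebra.ι Kq AGen.a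
        - FreeAlgebra.ι Kq AGen.d * FreeAlgebra.ι Kq AGen.d))
  | ac : ARel (FreeAlgebra.ι Kq AGen.a * FreeAlgebra.ι Kq AGen.c
        - FreeAlgebra.ι Kq AGen.c * FreeAlgebra.ι Kq AGen.a)
      ((1 - qv⁻¹ ^ 2) • (FreeAlgebra.ι Kq AGen.d * FreeAlgebra.ι Kq AGen.c))
  | det : ARel (FreeAlgebra.ι Kq AGen.a * FreeAlgebra.ι Kq AGen.d
        - (qv ^ 2) • (FreeAlgebra.ι Kq AGen.b * FreeAlgebra.ι Kq AGen.c)) 1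

/-- The algebra `𝒜 = ℒ_{0,1}(sl(2))`, presented by generators and relations. -/
abbrev Aalg : Type := RingQuot ARel

noncomputable def aA : Aalg := RingQuot.mkAlgHom Kq ARel (FreeAlgebra.ι Kq AGen.a)
noncomputable def bA : Aalg := RingQuot.mkAlgHom Kq ARel (FreeAlgebra.ι Kq AGen.b)
noncomputable def cA : Aalg := RingQuot.mkAlgHom Kq ARel (FreeAlgebra.ι Kq AGen.c)
noncomputable def dA : Aalg := RingQuot.mkAlgHom Kq ARel (FreeAlgebra.ι Kq AGen.d)

/-- The element `ω = q a + q⁻¹ d`. -/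
noncomputable def ωA : Aalg := qv • aA + qv⁻¹ • dA

/-- Generators `E`, `F`, `K`, `K⁻¹` of the quantum group `U_q(sl(2))`. -/
inductive UGen : Type
  | E | F | K | Kinv

/-- The defining relations of `U_q(sl(2))`. -/
inductive URel : FreeAlgebra Kq UGen → FreeAlgebra Kq UGen → Prop
  | KKinv : URel (FreeAlgebra.ι Kq UGen.K * FreeAlgebra.ι Kq UGen.Kinv) 1
  | KinvK : URel (FreeAlgebra.ι Kq UGen.Kinv * FreeAlgebra.ι Kq UGen.K) 1
  | KE : URel (FreeAlgebra.ι Kq UGen.K * FreeAlgebra.ι Kq UGen.E * FreeAlgebra.ι Kq UGen.Kinv)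
      ((qv ^ 2) • FreeAlgebra.ι Kq UGen.E)
  | KF : URel (FreeAlgebra.ι Kq UGen.K * FreeAlgebra.ι Kq UGen.F * FreeAlgebra.ι Kq UGen.Kinv)
      ((qv⁻¹ ^ 2) • FreeAlgebra.ι Kq UGen.F)
  | EF : URel (FreeAlgebra.ι Kq UGen.E * FreeAlgebra.ι Kq UGen.F
        - FreeAlgebra.ι Kq UGen.F * FreeAlgebra.ι Kq UGen.E)
      (((qv - qv⁻¹)⁻¹) • (FreeAlgebra.ι Kq UGen.K - FreeAlgebra.ι Kq UGen.Kinv))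

/-- The quantum group `U_q = U_q(sl(2))`, presented by generators and relations. -/
abbrev Uq : Type := RingQuot URel

noncomputable def Eel : Uq := RingQuot.mkAlgHom Kq URel (FreeAlgebra.ι Kq UGen.E)
noncomputable def Fel : Uq := RingQuot.mkAlgHom Kq URel (FreeAlgebra.ι Kq UGen.F)
noncomputable def Kel : Uq := RingQuot.mkAlgHom Kq URel (FreeAlgebra.ι Kq UGen.K)
noncomputable def Kinvel : Uq := RingQuot.mkAlgHom Kq URel (FreeAlgebra.ι Kq UGen.Kinv)

/-! ### Generation of quotients of free algebras -/

/-- A subspace of an algebra presented by generators and relations which contains `1` and is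
stable under left multiplication by the generators is the whole algebra. -/
lemma RingQuot.submodule_eq_top_of_generator_mul_mem {X : Type}
    {r : FreeAlgebra Kq X → FreeAlgebra Kq X → Prop} (W : Submodule Kq (RingQuot r))
    (one_mem : 1 ∈ W)
    (mul_mem : ∀ x, ∀ u ∈ W, RingQuot.mkAlgHom Kq r (FreeAlgebra.ι Kq x) * u ∈ W) : W = ⊤ := by
  have key : ∀ p : FreeAlgebra Kq X, ∀ u ∈ W, RingQuot.mkAlgHom Kq r p * u ∈ W := by
    intro p
    induction p using FreeAlgebra.induction with
    | grade0 t =>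
      intro u hu
      rw [AlgHom.commutes, ← Algebra.smul_def]
      exact W.smul_mem t hu
    | grade1 x => exact mul_mem x
    | mul p p' hp hp' =>
      intro u hu
      rw [map_mul, mul_assoc]
      exact hp _ (hp' u hu)
    | add p p' hp hp' =>
      intro u hu
      rw [map_add, add_mul]
      exact W.add_mem (hp u hu) (hp' u hu)
  rw [eq_top_iff]
  rintro u -
  obtain ⟨p, rfl⟩ := RingQuot.mkAlgHom_surjective Kq r u
  simpa using key p 1 one_mem

lemma qv_ne_zero : qv ≠ 0 := RatFunc.X_ne_zero

lemma qv_sub_inv_ne_zero : qv - qv⁻¹ ≠ 0 := by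
  intro h
  have h2 : qv ^ 2 = 1 := by
    have := qv_ne_zero
    field_simp at h
    linear_combination h
  have h3 : (Polynomial.X ^ 2 : Polynomial ℂ) = 1 := by
    apply RatFunc.algebraMap_injective ℂ
    simpa [qv] using h2
  simpa using congrArg (Polynomial.eval 0) h3

section Identities

variable {k A : Type*} [Field k] [Ring A] [Algebra k A] {q : k} {a b c d w : A}

lemma eq_smul_sub_smul (hq : q ≠ 0) (a d : A) : a = q⁻¹ • (q • a + q⁻¹ • d) - (q⁻¹ ^ 2) • d := by
  match_scalars <;> field_simp; ring

lemma smul_add_smul_mul_comm (hq : q ≠ 0) (hab : a * b - b * a = (-(1 - q⁻¹ ^ 2)) • (b * d))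
    (hdb : d * b = q ^ 2 • (b * d)) :
    (q • a + q⁻¹ • d) * b = b * (q • a + q⁻¹ • d) := by
  simp only [add_mul, mul_add, smul_mul_assoc, mul_smul_comm]
  linear_combination (norm := skip) q • hab + q⁻¹ • hdb
  match_scalars <;> field_simp <;> ring

lemma smul_add_smul_mul_comm' (hq : q ≠ 0) (hac : a * c - c * a = (1 - q⁻¹ ^ 2) • (d * c))
    (hcd : c * d = q ^ 2 • (d * c)) :
    (q • a + q⁻¹ • d) * c = c * (q • a + q⁻¹ • d) := by
  simp only [add_mul, mul_add, smul_mul_assoc, mul_smul_comm]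
  linear_combination (norm := skip) q • hac - q⁻¹ • hcd
  match_scalars <;> field_simp <;> ring

lemma mul_eq_of_det (hq : q ≠ 0) (hdet : a * d - q ^ 2 • (b * c) = 1)
    (ha : a = q⁻¹ • w - (q⁻¹ ^ 2) • d) :
    b * c = (q⁻¹ ^ 3) • (w * d) - (q⁻¹ ^ 4) • (d * d) - (q⁻¹ ^ 2) • (1 : A) := by
  rw [ha, sub_mul, smul_mul_assoc, smul_mul_assoc] at hdet
  linear_combination (norm := skip) (-q⁻¹ ^ 2) • hdet
  match_scalars <;> field_simp <;> ring

lemma mul_eq_of_commutator (hq : q ≠ 0) (hcb : c * b - b * c = (1 - q⁻¹ ^ 2) • (d * a - d * d))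
    (had : a * d = d * a)
    (hbc : b * c = (q⁻¹ ^ 3) • (w * d) - (q⁻¹ ^ 4) • (d * d) - (q⁻¹ ^ 2) • (1 : A))
    (ha : a = q⁻¹ • w - (q⁻¹ ^ 2) • d) :
    c * b = q⁻¹ • (w * d) - d * d - (q⁻¹ ^ 2) • (1 : A) := by
  rw [← had, ha, sub_mul, smul_mul_assoc, smul_mul_assoc] at hcb
  linear_combination (norm := skip) hcb + hbc
  match_scalars <;> field_simp <;> ring

end Identities

/-! ### Relations in `𝒜` -/

lemma aA_mul_dA : aA * dA = dA * aA := by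
  simpa [aA, dA] using RingQuot.mkAlgHom_rel Kq ARel.ad_comm

lemma dA_mul_bA : dA * bA = qv ^ 2 • (bA * dA) := by
  simpa [bA, dA] using RingQuot.mkAlgHom_rel Kq ARel.db

lemma cA_mul_dA : cA * dA = qv ^ 2 • (dA * cA) := by
  simpa [cA, dA] using RingQuot.mkAlgHom_rel Kq ARel.cd

lemma dA_mul_cA : dA * cA = (qv ^ 2)⁻¹ • (cA * dA) := by
  rw [cA_mul_dA, inv_smul_smul₀ (pow_ne_zero 2 qv_ne_zero)]

lemma aA_mul_bA : aA * bA - bA * aA = (-(1 - qv⁻¹ ^ 2)) • (bA * dA) := by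
  have h := RingQuot.mkAlgHom_rel Kq ARel.ab
  rwa [map_sub, map_smul, map_mul, map_mul, map_mul] at h

lemma cA_mul_bA : cA * bA - bA * cA = (1 - qv⁻¹ ^ 2) • (dA * aA - dA * dA) := by
  have h := RingQuot.mkAlgHom_rel Kq ARel.cb
  rwa [map_sub, map_smul, map_sub, map_mul, map_mul, map_mul, map_mul] at h

lemma aA_mul_cA : aA * cA - cA * aA = (1 - qv⁻¹ ^ 2) • (dA * cA) := by
  have h := RingQuot.mkAlgHom_rel Kq ARel.ac
  rwa [map_sub, map_smul, map_mul, map_mul, map_mul] at h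

lemma det_aA : aA * dA - qv ^ 2 • (bA * cA) = 1 := by
  have h := RingQuot.mkAlgHom_rel Kq ARel.det
  rwa [map_sub, map_smul, map_mul, map_mul, map_one] at h

lemma aA_eq : aA = qv⁻¹ • ωA - (qv⁻¹ ^ 2) • dA := by
  rw [ωA]
  exact eq_smul_sub_smul qv_ne_zero _ _

lemma ωA_mul_dA : ωA * dA = dA * ωA := by
  simp only [ωA, add_mul, mul_add, smul_mul_assoc, mul_smul_comm, aA_mul_dA]

lemma ωA_mul_bA : ωA * bA = bA * ωA :=
  smul_add_smul_mul_comm qv_ne_zero aA_mul_bA dA_mul_bA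

lemma ωA_mul_cA : ωA * cA = cA * ωA :=
  smul_add_smul_mul_comm' qv_ne_zero aA_mul_cA cA_mul_dA

lemma bA_mul_cA_eq :
    bA * cA = (qv⁻¹ ^ 3) • (ωA * dA) - (qv⁻¹ ^ 4) • (dA * dA) - (qv⁻¹ ^ 2) • (1 : Aalg) :=
  mul_eq_of_det qv_ne_zero det_aA aA_eq

lemma cA_mul_bA_eq :
    cA * bA = qv⁻¹ • (ωA * dA) - dA * dA - (qv⁻¹ ^ 2) • (1 : Aalg) :=
  mul_eq_of_commutator qv_ne_zero cA_mul_bA aA_mul_dA bA_mul_cA_eq aA_eq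

/-! ### The element `d` is normal -/

lemma exists_dA_mul_eq (x : Aalg) : ∃ y, dA * x = y * dA := by
  let W : Submodule Kq Aalg :=
    (LinearMap.range (LinearMap.mulRight Kq dA)).comap (LinearMap.mulLeft Kq dA)
  have mem : ∀ u, u ∈ W ↔ ∃ y, y * dA = dA * u := fun u => Iff.rfl
  have hW : W = ⊤ := by
    apply RingQuot.submodule_eq_top_of_generator_mul_mem
    · exact (mem 1).2 ⟨1, by simp⟩
    · rintro g u hu
      obtain ⟨y, hy⟩ := (mem u).1 hu
      rw [mem]
      have step : ∀ z z' : Aalg, dA * z = z' * dA → ∃ y, y * dA = dA * (z * u) := fun z z' h =>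
        ⟨z' * y, by rw [mul_assoc, hy, ← mul_assoc, ← h, mul_assoc]⟩
      cases g with
      | a => exact step aA aA aA_mul_dA.symm
      | b => exact step bA (qv ^ 2 • bA) (by rw [dA_mul_bA, smul_mul_assoc])
      | c => exact step cA ((qv ^ 2)⁻¹ • cA) (by rw [dA_mul_cA, smul_mul_assoc])
      | d => exact step dA dA rfl
  obtain ⟨y, hy⟩ := (mem x).1 (hW ▸ Submodule.mem_top)
  exact ⟨y, hy.symm⟩

lemma exists_mul_dA_eq (x : Aalg) : ∃ y, x * dA = dA * y := by
  let W : Submodule Kq Aalg :=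
    (LinearMap.range (LinearMap.mulLeft Kq dA)).comap (LinearMap.mulRight Kq dA)
  have mem : ∀ u, u ∈ W ↔ ∃ y, dA * y = u * dA := fun u => Iff.rfl
  have hW : W = ⊤ := by
    apply RingQuot.submodule_eq_top_of_generator_mul_mem
    · exact (mem 1).2 ⟨1, by simp⟩
    · rintro g u hu
      obtain ⟨y, hy⟩ := (mem u).1 hu
      rw [mem]
      have step : ∀ z z' : Aalg, z * dA = dA * z' → ∃ y, dA * y = z * u * dA := fun z z' h =>
        ⟨z' * y, by rw [mul_assoc, ← hy, ← mul_assoc, ← h, mul_assoc]⟩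
      cases g with
      | a => exact step aA aA aA_mul_dA
      | b => exact step bA ((qv ^ 2)⁻¹ • bA) (by
          rw [mul_smul_comm, dA_mul_bA, inv_smul_smul₀ (pow_ne_zero 2 qv_ne_zero)])
      | c => exact step cA (qv ^ 2 • cA) (by rw [cA_mul_dA, mul_smul_comm])
      | d => exact step dA dA rfl
  obtain ⟨y, hy⟩ := (mem x).1 (hW ▸ Submodule.mem_top)
  exact ⟨y, hy.symm⟩

lemma exists_dA_pow_mul_eq (x : Aalg) (n : ℕ) : ∃ y, dA ^ n * x = y * dA ^ n := by
  induction n with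
  | zero => exact ⟨x, by simp⟩
  | succ n ih =>
    obtain ⟨y, hy⟩ := ih
    obtain ⟨z, hz⟩ := exists_dA_mul_eq y
    exact ⟨z, by rw [pow_succ', mul_assoc, hy, ← mul_assoc, hz, mul_assoc]⟩

lemma exists_mul_dA_pow_eq (x : Aalg) (n : ℕ) : ∃ y, x * dA ^ n = dA ^ n * y := by
  induction n with
  | zero => exact ⟨x, by simp⟩
  | succ n ih =>
    obtain ⟨y, hy⟩ := ih
    obtain ⟨z, hz⟩ := exists_mul_dA_eq y
    exact ⟨z, by rw [pow_succ, ← mul_assoc, hy, mul_assoc, hz, mul_assoc]⟩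

/-! ### A spanning set of `𝒜` -/

/-- `b ^ m` for `m ≥ 0` and `c ^ (-m)` for `m < 0`. -/
def gradedMonomial : ℤ → Aalg
  | Int.ofNat i => bA ^ i
  | Int.negSucc j => cA ^ (j + 1)

/-- The elements `b ^ i ω ^ k d ^ l` and `c ^ j ω ^ k d ^ l`. -/
def standardMonomial (t : (ℕ × ℕ) × ℤ) : Aalg :=
  gradedMonomial t.2 * (ωA ^ t.1.1 * dA ^ t.1.2)

lemma exists_dA_mul_gradedMonomial (m : ℤ) :
    ∃ s : Kq, dA * gradedMonomial m = s • (gradedMonomial m * dA) := by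
  have aux : ∀ (g : Aalg) (s : Kq), dA * g = s • (g * dA) →
      ∀ n : ℕ, dA * g ^ n = s ^ n • (g ^ n * dA) := by
    intro g s h n
    induction n with
    | zero => simp
    | succ n ih =>
      rw [pow_succ, ← mul_assoc, ih, smul_mul_assoc, mul_assoc, h, mul_smul_comm, smul_smul,
        pow_succ, ← mul_assoc]
  cases m with
  | ofNat i => exact ⟨_, aux _ _ dA_mul_bA i⟩
  | negSucc j => exact ⟨_, aux _ _ dA_mul_cA (j + 1)⟩

lemma ωA_mul_gradedMonomial (m : ℤ) : ωA * gradedMonomial m = gradedMonomial m * ωA := by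
  cases m with
  | ofNat i => exact (Commute.pow_right (show Commute ωA bA from ωA_mul_bA) i).eq
  | negSucc j => exact (Commute.pow_right (show Commute ωA cA from ωA_mul_cA) (j + 1)).eq

lemma span_standardMonomial : Submodule.span Kq (Set.range standardMonomial) = ⊤ := by
  set W := Submodule.span Kq (Set.range standardMonomial)
  have mem : ∀ m k l, gradedMonomial m * (ωA ^ k * dA ^ l) ∈ W := fun m k l =>
    Submodule.subset_span ⟨((k, l), m), rfl⟩
  have extend : ∀ z : Aalg, (∀ m k l, z * (gradedMonomial m * (ωA ^ k * dA ^ l)) ∈ W) →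
      ∀ u ∈ W, z * u ∈ W := by
    intro z hz u hu
    induction hu using Submodule.span_induction with
    | mem u hu => obtain ⟨⟨⟨k, l⟩, m⟩, rfl⟩ := hu; exact hz m k l
    | zero => simp
    | add u v _ _ hu hv => rw [mul_add]; exact W.add_mem hu hv
    | smul s u _ hu => rw [mul_smul_comm]; exact W.smul_mem s hu
  have hω : ∀ u ∈ W, ωA * u ∈ W := extend _ fun m k l => by
    rw [← mul_assoc, ωA_mul_gradedMonomial, mul_assoc, ← mul_assoc ωA, ← pow_succ']
    exact mem m (k + 1) l
  have hd : ∀ u ∈ W, dA * u ∈ W := extend _ fun m k l => by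
    obtain ⟨s, hs⟩ := exists_dA_mul_gradedMonomial m
    have hc : dA * ωA ^ k = ωA ^ k * dA :=
      (Commute.pow_right (show Commute dA ωA from ωA_mul_dA.symm) k).eq
    rw [← mul_assoc, hs, smul_mul_assoc, mul_assoc, ← mul_assoc dA, hc, mul_assoc, ← pow_succ']
    exact W.smul_mem s (mem m k (l + 1))
  have hbc : ∀ u ∈ W, bA * (cA * u) ∈ W := fun u hu => by
    rw [← mul_assoc, bA_mul_cA_eq, sub_mul, sub_mul, smul_mul_assoc, smul_mul_assoc,
      smul_mul_assoc, mul_assoc, mul_assoc, one_mul]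
    exact W.sub_mem (W.sub_mem (W.smul_mem _ (hω _ (hd _ hu))) (W.smul_mem _ (hd _ (hd _ hu))))
      (W.smul_mem _ hu)
  have hcb : ∀ u ∈ W, cA * (bA * u) ∈ W := fun u hu => by
    rw [← mul_assoc, cA_mul_bA_eq, sub_mul, sub_mul, smul_mul_assoc,
      smul_mul_assoc, mul_assoc, mul_assoc, one_mul]
    exact W.sub_mem (W.sub_mem (W.smul_mem _ (hω _ (hd _ hu))) (hd _ (hd _ hu)))
      (W.smul_mem _ hu)
  have hb : ∀ u ∈ W, bA * u ∈ W := extend _ fun m k l => by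
    rcases m with i | _ | j
    · have h := mem (Int.ofNat (i + 1)) k l
      rwa [gradedMonomial, pow_succ', mul_assoc] at h
    · have h := hbc _ (mem 0 k l)
      simpa [gradedMonomial, ← Int.ofNat_zero, -Int.ofNat_eq_natCast] using h
    · have h := hbc _ (mem (Int.negSucc j) k l)
      rwa [← mul_assoc cA, gradedMonomial, ← pow_succ'] at h
  have hc : ∀ u ∈ W, cA * u ∈ W := extend _ fun m k l => by
    rcases m with (_ | i) | j
    · have h := mem (Int.negSucc 0) k l
      simpa [gradedMonomial] using h
    · have h := hcb _ (mem (Int.ofNat i) k l)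
      rwa [← mul_assoc bA, gradedMonomial, ← pow_succ'] at h
    · have h := mem (Int.negSucc (j + 1)) k l
      rwa [gradedMonomial, pow_succ', mul_assoc] at h
  apply RingQuot.submodule_eq_top_of_generator_mul_mem
  · simpa [gradedMonomial] using mem (Int.ofNat 0) 0 0
  · intro g u hu
    cases g with
    | a =>
      change aA * u ∈ W
      rw [aA_eq, sub_mul, smul_mul_assoc, smul_mul_assoc]
      exact W.sub_mem (W.smul_mem _ (hω u hu)) (W.smul_mem _ (hd u hu))
    | b => exact hb u hu
    | c => exact hc u hu
    | d => exact hd u hu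

/-! ### A family of representations of `U_q` by weighted shifts -/

section WeightedShift

variable {L : Type} [Field L]

/-- The operator sending the sequence `f` to `m ↦ g m * f (m + s)`. -/
def weightedShift (s : ℤ) (g : ℤ → L) : Module.End L (ℤ → L) where
  toFun f m := g m * f (m + s)
  map_add' f f' := by ext m; simp [mul_add]
  map_smul' t f := by ext m; simp [mul_left_comm]

lemma weightedShift_apply (s : ℤ) (g f : ℤ → L) (m : ℤ) :
    weightedShift s g f m = g m * f (m + s) := rfl

lemma weightedShift_single (s : ℤ) (g : ℤ → L) (n : ℤ) :
    weightedShift s g (Pi.single n 1) = g (n - s) • Pi.single (n - s) 1 := by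
  ext m
  rw [weightedShift_apply, Pi.smul_apply, smul_eq_mul]
  by_cases h : m = n - s
  · subst h
    simp
  · rw [Pi.single_eq_of_ne h, Pi.single_eq_of_ne (by omega), mul_zero, mul_zero]

variable [Algebra Kq L]

lemma smul_end_apply (s : Kq) (T : Module.End L (ℤ → L)) (f : ℤ → L) (m : ℤ) :
    (s • T) f m = algebraMap Kq L s * T f m :=
  Algebra.smul_def _ _

/-- The scalar `q` of an extension field of `ℂ(q)`. -/
def qL (L : Type) [Field L] [Algebra Kq L] : L := algebraMap Kq L qv

lemma qL_ne_zero : qL L ≠ 0 := by simpa [qL] using qv_ne_zero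

lemma qL_sub_inv_ne_zero : qL L - (qL L)⁻¹ ≠ 0 := by
  rw [qL, ← map_inv₀, ← map_sub]
  exact (map_ne_zero _).2 qv_sub_inv_ne_zero

lemma qL_sq_sub_one_ne_zero : qL L ^ 2 - 1 ≠ 0 := by
  have hq := qL_ne_zero (L := L)
  intro h
  apply qL_sub_inv_ne_zero (L := L)
  field_simp
  linear_combination h

/-- The eigenvalue of `b * c` on the weight vector on which `d` acts by `t`
and `ω` acts by `w`. -/
def bcWeight (w t : L) : L :=
  (qL L)⁻¹ ^ 3 * (w * t) - (qL L)⁻¹ ^ 4 * t ^ 2 - (qL L)⁻¹ ^ 2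

/-- The eigenvalue of `d` on the `m`-th weight vector. -/
def dWeight (y : L) (m : ℤ) : L := qL L ^ (2 * m) * y

lemma dWeight_add_one (y : L) (m : ℤ) : dWeight y (m + 1) = qL L ^ 2 * dWeight y m := by
  rw [dWeight, dWeight, mul_add, zpow_add₀ qL_ne_zero]
  simp only [mul_one, zpow_ofNat]
  ring

lemma dWeight_sub_one (y : L) (m : ℤ) : dWeight y (m - 1) = (qL L ^ 2)⁻¹ * dWeight y m := by
  have h := dWeight_add_one y (m - 1)
  rw [sub_add_cancel] at h
  rw [h, inv_mul_cancel_left₀ (pow_ne_zero 2 qL_ne_zero)]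

lemma dWeight_ne_zero {y : L} (hy : y ≠ 0) (m : ℤ) : dWeight y m ≠ 0 :=
  mul_ne_zero (zpow_ne_zero _ qL_ne_zero) hy

/-- The images of the generators of `U_q` under the weighted shift representation. -/
def shiftGen (w y : L) : UGen → Module.End L (ℤ → L)
  | .E => weightedShift 1
      fun m => (qL L - (qL L)⁻¹)⁻¹ * (dWeight y m)⁻¹ * bcWeight w (dWeight y (m + 1))
  | .F => weightedShift (-1) fun _ => ((qL L)⁻¹ * (qL L - (qL L)⁻¹))⁻¹
  | .K => weightedShift 0 fun m => (dWeight y m)⁻¹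
  | .Kinv => weightedShift 0 fun m => dWeight y m

/-- The representation of `U_q` by weighted shifts in which `K⁻¹` acts on the `m`-th weight
vector by `q ^ (2 * m) * y` and `Φ₁(ω)` acts by `w`. -/
def shiftRep (w : L) {y : L} (hy : y ≠ 0) : Uq →ₐ[Kq] Module.End L (ℤ → L) :=
  RingQuot.liftAlgHom Kq ⟨FreeAlgebra.lift Kq (shiftGen w y), by
    have hq := qL_ne_zero (L := L)
    have hq' := qL_sq_sub_one_ne_zero (L := L)
    have hd := dWeight_ne_zero hy
    intro u v huv
    cases huv <;> ext1 f <;> ext1 m <;>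
      simp only [map_mul, map_one, map_sub, map_smul, FreeAlgebra.lift_ι_apply, shiftGen,
        Module.End.mul_apply, Module.End.one_apply, LinearMap.sub_apply, Pi.sub_apply,
        smul_end_apply, weightedShift_apply, map_pow, map_inv₀, add_zero, add_sub_cancel_right,
        ← sub_eq_add_neg, sub_add_cancel, dWeight_add_one, dWeight_sub_one,
        ← qL.eq_1 L] <;>
      have hm := hd m
    · field_simp
    · field_simp
    · field_simp
    · field_simp
    · simp only [bcWeight]
      field_simp
      ring⟩

lemma shiftRep_mkAlgHom (w : L) {y : L} (hy : y ≠ 0) (g : UGen) :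
    shiftRep w hy (RingQuot.mkAlgHom Kq URel (FreeAlgebra.ι Kq g)) = shiftGen w y g := by
  rw [shiftRep, RingQuot.liftAlgHom_mkAlgHom_apply, FreeAlgebra.lift_ι_apply]

/-- If the monomials in `w` and `y` are linearly independent, then `b * c` acts on every weight
vector by a nonzero scalar. -/
lemma bcWeight_dWeight_ne_zero {w y : L}
    (h : LinearIndependent Kq fun p : ℕ × ℕ => w ^ p.1 * y ^ p.2) (m : ℤ) :
    bcWeight w (dWeight y m) ≠ 0 := by
  intro h0
  have hl := linearIndependent_iff.1 h
    (Finsupp.single (1, 1) (qv⁻¹ ^ 3 * qv ^ (2 * m))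
      - Finsupp.single (0, 2) (qv⁻¹ ^ 4 * (qv ^ (2 * m)) ^ 2) - Finsupp.single (0, 0) (qv⁻¹ ^ 2))
    (by
      rw [← h0]
      simp only [map_sub, Finsupp.linearCombination_single, Algebra.smul_def, map_mul, map_pow,
        map_inv₀, map_zpow₀, bcWeight, dWeight, ← qL.eq_1 L]
      ring)
  have := DFunLike.congr_fun hl (0, 0)
  simp [qv_ne_zero] at this

section Pullback

variable (Φ : Aalg →ₐ[Kq] Uq) (w : L) {y : L} (hy : y ≠ 0)

lemma shiftRep_dA (hΦd : Φ dA = Kinvel) :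
    shiftRep w hy (Φ dA) = weightedShift 0 (dWeight y) := by
  rw [hΦd, Kinvel, shiftRep_mkAlgHom]
  rfl

lemma shiftRep_bA (hΦb : Φ bA = (qv⁻¹ * (qv - qv⁻¹)) • Fel) :
    shiftRep w hy (Φ bA) = weightedShift (-1) 1 := by
  have h : qv⁻¹ * (qv - qv⁻¹) ≠ 0 := mul_ne_zero (inv_ne_zero qv_ne_zero) qv_sub_inv_ne_zero
  have h' : (qL L)⁻¹ * (qL L - (qL L)⁻¹) ≠ 0 :=
    mul_ne_zero (inv_ne_zero qL_ne_zero) qL_sub_inv_ne_zero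
  rw [hΦb, map_smul, Fel, shiftRep_mkAlgHom]
  ext1 f
  ext1 m
  simp only [smul_end_apply, shiftGen, weightedShift_apply, map_mul, map_sub, map_inv₀,
    ← qL.eq_1 L, mul_inv_cancel_left₀ h', Pi.one_apply, one_mul]

lemma shiftRep_cA (hΦc : Φ cA = (qv - qv⁻¹) • (Kinvel * Eel)) :
    shiftRep w hy (Φ cA) = weightedShift 1 fun m => bcWeight w (dWeight y (m + 1)) := by
  have h' := qL_sub_inv_ne_zero (L := L)
  rw [hΦc, map_smul, map_mul, Kinvel, Eel, shiftRep_mkAlgHom, shiftRep_mkAlgHom]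
  ext1 f
  ext1 m
  have hm := dWeight_ne_zero hy m
  simp only [smul_end_apply, shiftGen, Module.End.mul_apply, weightedShift_apply, map_sub,
    map_inv₀, ← qL.eq_1 L, add_zero]
  rw [mul_assoc (qL L - (qL L)⁻¹)⁻¹, mul_assoc (qL L - (qL L)⁻¹)⁻¹, mul_left_comm (dWeight y m),
    mul_inv_cancel_left₀ h', mul_assoc, mul_inv_cancel_left₀ hm]

lemma shiftRep_ωA (hΦa : Φ aA = Kel + (qv⁻¹ * (qv - qv⁻¹) ^ 2) • (Fel * Eel))
    (hΦd : Φ dA = Kinvel) :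
    shiftRep w hy (Φ ωA) = w • 1 := by
  have hq := qL_ne_zero (L := L)
  have hq' : qL L ^ 2 - 1 ≠ 0 := qL_sq_sub_one_ne_zero
  rw [ωA, map_add, map_smul, map_smul, hΦa, hΦd, Kel, Kinvel, Fel, Eel]
  simp only [map_add, map_smul, map_mul, shiftRep_mkAlgHom]
  ext1 f
  ext1 m
  have hm := dWeight_ne_zero hy m
  have hw : (w • (1 : Module.End L (ℤ → L))) f m = w * f m := rfl
  simp only [smul_end_apply, shiftGen, Module.End.mul_apply,
    LinearMap.add_apply, Pi.add_apply, hw,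
    weightedShift_apply, map_mul, map_sub, map_pow, map_inv₀, ← qL.eq_1 L, add_zero,
    ← sub_eq_add_neg, sub_add_cancel, dWeight_sub_one, bcWeight]
  field_simp
  ring

/-- The powers of `b` and `c` map the weight vector at `0` to nonzero multiples of weight
vectors. -/
lemma exists_shiftRep_gradedMonomial (hΦb : Φ bA = (qv⁻¹ * (qv - qv⁻¹)) • Fel)
    (hΦc : Φ cA = (qv - qv⁻¹) • (Kinvel * Eel)) (hbc : ∀ m, bcWeight w (dWeight y m) ≠ 0)
    (m : ℤ) :
    ∃ κ : Lˣ, shiftRep w hy (Φ (gradedMonomial m)) (Pi.single 0 1) =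
      κ • (Pi.single m 1 : ℤ → L) := by
  have hb : ∀ i : ℕ, shiftRep w hy (Φ (bA ^ i)) (Pi.single 0 1) = Pi.single (i : ℤ) 1 := by
    intro i
    induction i with
    | zero => simp
    | succ i ih =>
      rw [pow_succ', map_mul, map_mul, Module.End.mul_apply, ih, shiftRep_bA Φ w hy hΦb,
        weightedShift_single]
      simp
  have hc : ∀ j : ℕ, ∃ κ : Lˣ, shiftRep w hy (Φ (cA ^ j)) (Pi.single 0 1) =
      κ • (Pi.single (-j : ℤ) 1 : ℤ → L) := by
    intro j
    induction j with
    | zero => exact ⟨1, by simp⟩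
    | succ j ih =>
      obtain ⟨κ, hκ⟩ := ih
      refine ⟨κ * Units.mk0 _ (hbc (-j)), ?_⟩
      rw [pow_succ', map_mul, map_mul, Module.End.mul_apply, hκ, shiftRep_cA Φ w hy hΦc,
        LinearMap.map_smul_of_tower, weightedShift_single, mul_smul, Units.smul_mk0,
        sub_add_cancel, Nat.cast_succ, neg_add, sub_eq_add_neg]
  cases m with
  | ofNat i => exact ⟨1, by rw [one_smul]; exact hb i⟩
  | negSucc j =>
    obtain ⟨κ, hκ⟩ := hc (j + 1)
    exact ⟨κ, hκ⟩

lemma shiftRep_ωA_pow_mul_dA_pow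
    (hΦa : Φ aA = Kel + (qv⁻¹ * (qv - qv⁻¹) ^ 2) • (Fel * Eel))
    (hΦd : Φ dA = Kinvel) (k l : ℕ) :
    shiftRep w hy (Φ (ωA ^ k * dA ^ l)) (Pi.single 0 1) =
      (w ^ k * y ^ l) • (Pi.single 0 1 : ℤ → L) := by
  have hd : ∀ l : ℕ, shiftRep w hy (Φ (dA ^ l)) (Pi.single 0 1) =
      y ^ l • (Pi.single 0 1 : ℤ → L) := by
    intro l
    induction l with
    | zero => simp
    | succ l ih =>
      rw [pow_succ', map_mul, map_mul, Module.End.mul_apply, ih, shiftRep_dA Φ w hy hΦd,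
        map_smul, weightedShift_single, smul_smul, pow_succ]
      simp [dWeight]
  rw [map_mul, map_mul, Module.End.mul_apply, hd, map_pow, map_pow, shiftRep_ωA Φ w hy hΦa hΦd,
    smul_pow, one_pow, LinearMap.smul_apply, Module.End.one_apply, smul_smul]

end Pullback

end WeightedShift

/-! ### Injectivity of `Φ₁` -/

lemma linearIndependent_pow_mul_pow (k : Type) [Field k] :
    LinearIndependent k fun p : ℕ × ℕ =>
      (algebraMap (Polynomial (Polynomial k)) (FractionRing (Polynomial (Polynomial k)))
        (Polynomial.C Polynomial.X)) ^ p.1 *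
      (algebraMap (Polynomial (Polynomial k)) (FractionRing (Polynomial (Polynomial k)))
        Polynomial.X) ^ p.2 := by
  have h (R : Type) [CommRing R] :
      LinearIndependent R fun n : ℕ => (Polynomial.X : Polynomial R) ^ n := by
    simpa [Polynomial.coe_basisMonomials, Polynomial.X_pow_eq_monomial] using
      (Polynomial.basisMonomials R).linearIndependent
  have h2 : LinearIndependent k fun p : ℕ × ℕ =>
      algebraMap (Polynomial (Polynomial k)) (FractionRing (Polynomial (Polynomial k)))
        ((Polynomial.X : Polynomial k) ^ p.1 • (Polynomial.X : Polynomial (Polynomial k)) ^ p.2) :=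
    (linearIndependent_smul (h k) (h (Polynomial k))).map'
      (IsScalarTower.toAlgHom k (Polynomial (Polynomial k))
        (FractionRing (Polynomial (Polynomial k)))).toLinearMap
      (LinearMap.ker_eq_bot.2 (IsFractionRing.injective _ _))
  simpa [Polynomial.smul_eq_C_mul] using h2

lemma injective_of_map_generators (Φ : Aalg →ₐ[Kq] Uq)
    (hΦa : Φ aA = Kel + (qv⁻¹ * (qv - qv⁻¹) ^ 2) • (Fel * Eel))
    (hΦb : Φ bA = (qv⁻¹ * (qv - qv⁻¹)) • Fel)
    (hΦc : Φ cA = (qv - qv⁻¹) • (Kinvel * Eel))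
    (hΦd : Φ dA = Kinvel) : Function.Injective Φ := by
  have hind := linearIndependent_pow_mul_pow Kq
  set L := FractionRing (Polynomial (Polynomial Kq))
  set w := algebraMap (Polynomial (Polynomial Kq)) L (Polynomial.C Polynomial.X)
  set y := algebraMap (Polynomial (Polynomial Kq)) L Polynomial.X
  have hy : y ≠ 0 := by simpa using hind.ne_zero (0, 1)
  choose κ hκ using exists_shiftRep_gradedMonomial Φ w hy hΦb hΦc (bcWeight_dWeight_ne_zero hind)
  have hV : LinearIndependent L fun m => κ m • (Pi.single m 1 : ℤ → L) :=
    (Pi.linearIndependent_single_one ℤ L).units_smul κ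
  let ev : Aalg →ₗ[Kq] (ℤ → L) :=
    { toFun := fun x => shiftRep w hy (Φ x) (Pi.single 0 1)
      map_add' := fun x x' => by simp
      map_smul' := fun s x => by simp }
  have hev : LinearIndependent Kq (ev ∘ standardMonomial) := by
    convert linearIndependent_smul hind hV using 1
    funext t
    change shiftRep w hy (Φ (standardMonomial t)) (Pi.single 0 1) = _
    rw [standardMonomial, map_mul, map_mul, Module.End.mul_apply,
      shiftRep_ωA_pow_mul_dA_pow Φ w hy hΦa hΦd, map_smul, hκ]
  rw [injective_iff_map_eq_zero]
  intro x hx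
  have hx' : x ∈ Submodule.span Kq (Set.range standardMonomial) :=
    span_standardMonomial ▸ Submodule.mem_top
  obtain ⟨f, rfl⟩ := (Finsupp.mem_span_range_iff_exists_finsupp).1 hx'
  have h0 : ev (f.sum fun i a => a • standardMonomial i) = 0 := by
    change shiftRep w hy (Φ _) _ = 0
    rw [hx, map_zero, LinearMap.zero_apply]
  have hf : f = 0 := by
    apply linearIndependent_iff.1 hev
    rw [← h0, Finsupp.linearCombination_apply, map_finsuppSum]
    simp
  rw [hf, Finsupp.sum_zero_index]

/-! ### Surjectivity of the extension of `Φ₁` -/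

lemma Kel_mul_Kinvel : Kel * Kinvel = 1 := by
  simpa [Kel, Kinvel] using RingQuot.mkAlgHom_rel Kq URel.KKinv

lemma Kinvel_mul_Kel : Kinvel * Kel = 1 := by
  simpa [Kel, Kinvel] using RingQuot.mkAlgHom_rel Kq URel.KinvK

lemma exists_eq_map_mul_Kel_pow (Φ : Aalg →ₐ[Kq] Uq)
    (hΦb : Φ bA = (qv⁻¹ * (qv - qv⁻¹)) • Fel)
    (hΦc : Φ cA = (qv - qv⁻¹) • (Kinvel * Eel))
    (hΦd : Φ dA = Kinvel) (u : Uq) : ∃ (x : Aalg) (n : ℕ), u = Φ x * Kel ^ n := by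
  have hpow : ∀ n : ℕ, Kinvel ^ n * Kel ^ n = 1 := fun n => by
    rw [← (show Commute Kinvel Kel from Kinvel_mul_Kel.trans Kel_mul_Kinvel.symm).mul_pow,
      Kinvel_mul_Kel, one_pow]
  have shift : ∀ (x : Aalg) (n m : ℕ), Φ x * Kel ^ n = Φ (x * dA ^ m) * Kel ^ (m + n) := by
    intro x n m
    rw [map_mul, map_pow, hΦd, pow_add, mul_assoc, ← mul_assoc (Kinvel ^ m), hpow, one_mul]
  let W : Submodule Kq Uq :=
    { carrier := {u | ∃ (x : Aalg) (n : ℕ), u = Φ x * Kel ^ n}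
      zero_mem' := ⟨0, 0, by simp⟩
      add_mem' := by
        rintro _ _ ⟨x, n, rfl⟩ ⟨x', n', rfl⟩
        refine ⟨x * dA ^ n' + x' * dA ^ n, n + n', ?_⟩
        rw [shift x n n', shift x' n' n, map_add, add_mul, add_comm n' n]
      smul_mem' := by
        rintro s _ ⟨x, n, rfl⟩
        exact ⟨s • x, n, by rw [map_smul, smul_mul_assoc]⟩ }
  have hmap : ∀ z : Aalg, ∀ u ∈ W, Φ z * u ∈ W := by
    rintro z _ ⟨x, n, rfl⟩
    exact ⟨z * x, n, by rw [map_mul, mul_assoc]⟩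
  have hK : ∀ u ∈ W, Kel * u ∈ W := by
    rintro _ ⟨x, n, rfl⟩
    obtain ⟨y, hy⟩ := exists_mul_dA_eq x
    refine ⟨y, n + 1, ?_⟩
    have h := congrArg Φ hy
    rw [map_mul, map_mul, hΦd] at h
    calc Kel * (Φ x * Kel ^ n) = Kel * (Φ x * Kinvel) * (Kel * Kel ^ n) := by
          simp only [mul_assoc]
          rw [← mul_assoc Kinvel Kel, Kinvel_mul_Kel, one_mul]
      _ = Φ y * Kel ^ (n + 1) := by
          rw [h, ← mul_assoc Kel, Kel_mul_Kinvel, one_mul, pow_succ']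
  have hW : W = ⊤ := by
    apply RingQuot.submodule_eq_top_of_generator_mul_mem
    · exact ⟨1, 0, by simp⟩
    · intro g u hu
      cases g with
      | E =>
        have h : Eel = (qv - qv⁻¹)⁻¹ • (Kel * Φ cA) := by
          rw [hΦc, mul_smul_comm, inv_smul_smul₀ qv_sub_inv_ne_zero, ← mul_assoc,
            Kel_mul_Kinvel, one_mul]
        change Eel * u ∈ W
        rw [h, smul_mul_assoc, mul_assoc]
        exact W.smul_mem _ (hK _ (hmap _ u hu))
      | F =>
        have h : Fel = (qv⁻¹ * (qv - qv⁻¹))⁻¹ • Φ bA := by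
          rw [hΦb, inv_smul_smul₀ (mul_ne_zero (inv_ne_zero qv_ne_zero) qv_sub_inv_ne_zero)]
        change Fel * u ∈ W
        rw [h, smul_mul_assoc]
        exact W.smul_mem _ (hmap _ u hu)
      | K => exact hK u hu
      | Kinv =>
        change Kinvel * u ∈ W
        rw [← hΦd]
        exact hmap _ u hu
  exact (hW ▸ Submodule.mem_top : u ∈ W)


/-- `d` is regular in `𝒜`, the powers of `d` form a left and right Ore set in `𝒜`, and
`Φ₁` extends to an isomorphism of `ℂ(q)`-algebras from the Ore localization of `𝒜` at
`{dⁿ}` onto `U_q`, sending `d⁻¹` to `K`.  Concretely: `Φ₁` is injective, `Φ₁(d)` is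
invertible with inverse `K` (so the extension sends `d⁻¹` to `K`), and every element
of `U_q` is a right fraction `Φ₁(x) Kⁿ = Φ₁(x) Φ₁(d)⁻ⁿ`, so that the induced map from
the Ore localization is bijective onto `U_q`. -/
theorem statement3 (Φ : Aalg →ₐ[Kq] Uq)
    (hΦa : Φ aA = Kel + (qv⁻¹ * (qv - qv⁻¹) ^ 2) • (Fel * Eel))
    (hΦb : Φ bA = (qv⁻¹ * (qv - qv⁻¹)) • Fel)
    (hΦc : Φ cA = (qv - qv⁻¹) • (Kinvel * Eel))
    (hΦd : Φ dA = Kinvel) :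
    (∀ x : Aalg, dA * x = 0 → x = 0)
    ∧ (∀ x : Aalg, x * dA = 0 → x = 0)
    ∧ (∀ (x : Aalg) (n : ℕ), ∃ (y : Aalg) (m : ℕ), dA ^ m * x = y * dA ^ n)
    ∧ (∀ (x : Aalg) (n : ℕ), ∃ (y : Aalg) (m : ℕ), x * dA ^ m = dA ^ n * y)
    ∧ Function.Injective Φ
    ∧ Φ dA * Kel = 1 ∧ Kel * Φ dA = 1
    ∧ (∀ u : Uq, ∃ (x : Aalg) (n : ℕ), u = Φ x * Kel ^ n) := by
  have inj := injective_of_map_generators Φ hΦa hΦb hΦc hΦd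
  refine ⟨fun x hx => inj ?_, fun x hx => inj ?_, fun x n => ?_, fun x n => ?_, inj, ?_, ?_,
    exists_eq_map_mul_Kel_pow Φ hΦb hΦc hΦd⟩
  · have h := congrArg Φ hx
    rw [map_mul, hΦd, map_zero] at h
    rw [map_zero, ← one_mul (Φ x), ← Kel_mul_Kinvel, mul_assoc, h, mul_zero]
  · have h := congrArg Φ hx
    rw [map_mul, hΦd, map_zero] at h
    rw [map_zero, ← mul_one (Φ x), ← Kinvel_mul_Kel, ← mul_assoc, h, zero_mul]
  · obtain ⟨y, hy⟩ := exists_dA_pow_mul_eq x n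
    exact ⟨y, n, hy⟩
  · obtain ⟨y, hy⟩ := exists_mul_dA_pow_eq x n
    exact ⟨y, n, hy⟩
  · rw [hΦd, Kinvel_mul_Kel]
  · rw [hΦd, Kel_mul_Kinvel]
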